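/- arXiv:2509.05767 — 2 statements merged into one kernel-verified Lean document; each statement's English description precedes it below -/
import Mathlib

section
/- Let R be a commutative noetherian ring, M and N finitely generated R-modules such that add M = add N (each of M, N is a direct summand of a finite direct sum of copies of the other). Then the centers of the endomorphism rings Z(End_R(M)) and Z(End_R(N)) are isomorphic as R-algebras. -/
/-- A retraction onto `N` from `M^n` decomposes the identity of `N`. -/
theorem decomp_of_retract {R M N : Type} [CommRing R]
    [AddCommGroup M] [Module R M] [AddCommGroup N] [Module R N]
    (h : ∃ (n : ℕ) (i : N →ₗ[R] (Fin n → M)) (π : (Fin n → M) →ₗ[R] N),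
      π ∘ₗ i = LinearMap.id) :
    ∃ (n : ℕ) (a : Fin n → N →ₗ[R] M) (b : Fin n → M →ₗ[R] N),
      ∀ x, ∑ k, b k (a k x) = x := by
  obtain ⟨n, i, p, h⟩ := h
  refine ⟨n, fun k => LinearMap.proj k ∘ₗ i, fun k => p ∘ₗ LinearMap.single R (fun _ => M) k, fun x => ?_⟩
  have h1 : p (i x) = x := LinearMap.congr_fun h x
  simp only [LinearMap.comp_apply, LinearMap.proj_apply, LinearMap.coe_single]
  rw [← map_sum, Finset.univ_sum_single, h1]

section
variable {R M N : Type} [CommRing R]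
    [AddCommGroup M] [Module R M] [AddCommGroup N] [Module R N]

theorem center_apply_comm (z : Subalgebra.center R (Module.End R M)) (f : Module.End R M) (x : M) :
    f (z.1 x) = z.1 (f x) :=
  LinearMap.congr_fun (Subalgebra.mem_center_iff.1 z.2 f) x

/-- The transported endomorphism `∑ b_k z a_k`. -/
def transportEnd {n : ℕ} (a : Fin n → N →ₗ[R] M) (b : Fin n → M →ₗ[R] N)
    (z : Module.End R M) : Module.End R N := ∑ k, b k ∘ₗ z ∘ₗ a k

theorem transportEnd_apply {n : ℕ} (a : Fin n → N →ₗ[R] M) (b : Fin n → M →ₗ[R] N)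
    (z : Module.End R M) (x : N) : transportEnd a b z x = ∑ k, b k (z (a k x)) := by
  simp [transportEnd]

theorem transportEnd_comm {n : ℕ} (a : Fin n → N →ₗ[R] M) (b : Fin n → M →ₗ[R] N)
    (h : ∀ x, ∑ k, b k (a k x) = x) (z : Subalgebra.center R (Module.End R M))
    (f : M →ₗ[R] N) (x : M) : transportEnd a b z.1 (f x) = f (z.1 x) := by
  rw [transportEnd_apply, ← h (f (z.1 x))]
  refine Finset.sum_congr rfl fun k _ => ?_
  exact congrArg (b k) (center_apply_comm z (a k ∘ₗ f) x).symm

/-- The algebra homomorphism between centers. -/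
def transportHom {n : ℕ} (a : Fin n → N →ₗ[R] M) (b : Fin n → M →ₗ[R] N)
    (h : ∀ x, ∑ k, b k (a k x) = x) :
    Subalgebra.center R (Module.End R M) →ₐ[R] Subalgebra.center R (Module.End R N) :=
  AlgHom.ofLinearMap
    { toFun := fun z => ⟨transportEnd a b z.1, by
        rw [Subalgebra.mem_center_iff]
        intro g
        ext x
        change g (transportEnd a b z.1 x) = transportEnd a b z.1 (g x)
        conv_rhs => rw [← h x]
        rw [transportEnd_apply, map_sum, map_sum, map_sum]
        refine Finset.sum_congr rfl fun k _ => ?_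
        exact (transportEnd_comm a b h z (g ∘ₗ b k) (a k x)).symm⟩
      map_add' := fun z w => by
        ext x
        simp [transportEnd_apply, Finset.sum_add_distrib]
      map_smul' := fun r z => by
        ext x
        simp [transportEnd_apply, Finset.smul_sum] }
    (by
      ext x
      simp [transportEnd_apply, h])
    (fun z w => by
      ext x
      change transportEnd a b (z.1 * w.1) x = transportEnd a b z.1 (transportEnd a b w.1 x)
      rw [transportEnd_apply, transportEnd_apply a b w.1, map_sum]
      refine Finset.sum_congr rfl fun k _ => ?_
      exact (transportEnd_comm a b h z (b k) _).symm)

theorem transportHom_comp {n m : ℕ} (a : Fin n → N →ₗ[R] M) (b : Fin n → M →ₗ[R] N)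
    (h : ∀ x, ∑ k, b k (a k x) = x) (c : Fin m → M →ₗ[R] N) (d : Fin m → N →ₗ[R] M)
    (h' : ∀ x, ∑ k, d k (c k x) = x) :
    (transportHom c d h').comp (transportHom a b h) = AlgHom.id R _ := by
  ext z x
  change transportEnd c d (transportEnd a b z.1) x = z.1 x
  rw [transportEnd_apply, ← h' (z.1 x)]
  refine Finset.sum_congr rfl fun k _ => ?_
  rw [transportEnd_comm a b h z (c k)]
end

/-- Let `R` be a commutative noetherian ring and `M`, `N` finitely generated `R`-modules
with `add M = add N` (each is a direct summand of a finite direct sum of copies of the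
other).  Then the centers `Z(End_R M)` and `Z(End_R N)` are isomorphic `R`-algebras. -/
theorem center_end_iso_of_add_eq
    (R : Type) [CommRing R] [IsNoetherianRing R]
    (M N : Type) [AddCommGroup M] [Module R M] [AddCommGroup N] [Module R N]
    [Module.Finite R M] [Module.Finite R N]
    (hMN : ∃ (n : ℕ) (i : M →ₗ[R] (Fin n → N)) (π : (Fin n → N) →ₗ[R] M),
      π ∘ₗ i = LinearMap.id)
    (hNM : ∃ (n : ℕ) (i : N →ₗ[R] (Fin n → M)) (π : (Fin n → M) →ₗ[R] N),
      π ∘ₗ i = LinearMap.id) :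
    Nonempty (Subalgebra.center R (Module.End R M) ≃ₐ[R]
      Subalgebra.center R (Module.End R N)) := by
  obtain ⟨n, c, d, h'⟩ := decomp_of_retract hMN
  obtain ⟨m, a, b, h⟩ := decomp_of_retract hNM
  exact ⟨AlgEquiv.ofAlgHom (transportHom a b h) (transportHom c d h')
    (transportHom_comp c d h' a b h) (transportHom_comp a b h c d h')⟩
end

section
/- Let R → S be a finite ring homomorphism of commutative noetherian rings, φ : Spec S → Spec R the induced map, and M a finitely generated S-module. Then for every prime 𝔭 of R, depth_{R_𝔭} M_𝔭 = inf over primes 𝔮 of S lying over 𝔭 of depth_{S_𝔮} M_𝔮. -/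
open CategoryTheory

/-- The depth of a module `M` over a noetherian local ring `A`:
`inf { n | Ext^n_A(A/𝔪, M) ≠ 0 }`, with the convention that the depth of the
zero module is `∞` (the infimum of the empty set). -/
noncomputable def moduleDepth (A : Type) [CommRing A] [IsLocalRing A]
    (M : Type) [AddCommGroup M] [Module A M] : ℕ∞ :=
  sInf {d : ℕ∞ | ∃ n : ℕ, d = n ∧
    Nontrivial (((Ext A (ModuleCat A) n).obj
      (Opposite.op (ModuleCat.of A (IsLocalRing.ResidueField A)))).obj (ModuleCat.of A M))}

lemma ext_old_iff (A : Type) [CommRing A] (X Y : ModuleCat.{0} A) (n : ℕ) :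
    Subsingleton (((Ext A (ModuleCat A) n).obj (Opposite.op X)).obj Y) ↔
      Subsingleton (Abelian.Ext X Y n) := by
  let P := projectiveResolution X
  have h1 : Subsingleton (((Ext A (ModuleCat A) n).obj (Opposite.op X)).obj Y) ↔
      ((ChainComplex.linearYonedaObj P.complex A Y).ExactAt n) := by
    rw [HomologicalComplex.exactAt_iff_isZero_homology, ← (P.isoExt n Y).isZero_iff]
    exact ModuleCat.isZero_iff_subsingleton.symm
  rw [h1]
  cases n with
  | zero =>
    rw [HomologicalComplex.exactAt_iff' _ 0 0 1 (by simp) (by simp),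
      ShortComplex.moduleCat_exact_iff]
    rw [(Abelian.Ext.addEquiv₀ (X := X) (Y := Y)).subsingleton_congr]
    constructor
    · intro h
      refine subsingleton_of_forall_eq 0 fun f ↦ ?_
      let π₀ : P.complex.X 0 ⟶ X := P.π.f 0
      have hπ : P.complex.d 1 0 ≫ π₀ = 0 := P.complex_d_comp_π_f_zero
      have : Epi π₀ := inferInstanceAs (Epi (P.π.f 0))
      obtain ⟨g, hg⟩ := h (π₀ ≫ f) (by
        change P.complex.d 1 0 ≫ π₀ ≫ f = 0
        rw [reassoc_of% hπ, Limits.zero_comp])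
      let g₀ : P.complex.X 0 ⟶ Y := g
      have hg' : P.complex.d 0 0 ≫ g₀ = π₀ ≫ f := hg
      rw [P.complex.shape 0 0 (by simp), Limits.zero_comp] at hg'
      rw [← cancel_epi π₀, ← hg', Limits.comp_zero]
    · intro h f hf
      have hf' : P.complex.d 1 0 ≫ (f : P.complex.X 0 ⟶ Y) = 0 := hf
      obtain ⟨l, hl⟩ := Limits.CokernelCofork.IsColimit.desc' P.isColimitCokernelCofork
        (f : P.complex.X 0 ⟶ Y) hf'
      have hl0 : l = 0 := Subsingleton.elim (α := X ⟶ Y) l 0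
      refine ⟨0, ?_⟩
      rw [map_zero]
      change (0 : P.complex.X 0 ⟶ Y) = f
      rw [← hl, hl0, Limits.comp_zero]
  | succ n =>
    rw [HomologicalComplex.exactAt_iff' _ n (n+1) (n+2) (by simp) (by simp),
      ShortComplex.moduleCat_exact_iff]
    constructor
    · intro h
      refine subsingleton_of_forall_eq 0 fun a ↦ ?_
      obtain ⟨f, hf, rfl⟩ := P.extMk_surjective a (n+2) rfl
      rw [P.extMk_eq_zero_iff f _ rfl hf n rfl]
      exact h f hf
    · intro h f hf
      exact (P.extMk_eq_zero_iff f (n+2) rfl hf n rfl).1 (Subsingleton.elim _ _)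

lemma le_moduleDepth (A : Type) [CommRing A] [IsLocalRing A]
    (N : Type) [AddCommGroup N] [Module A N] (n : ℕ) :
    (n : ℕ∞) ≤ moduleDepth A N ↔ ∀ i < n,
      Subsingleton (Abelian.Ext (ModuleCat.of A (IsLocalRing.ResidueField A))
        (ModuleCat.of A N) i) := by
  simp only [moduleDepth, le_sInf_iff, Set.mem_ofPred_eq, forall_exists_index, and_imp]
  constructor
  · intro h i hi
    rw [← ext_old_iff]
    by_contra hc
    have := h i i rfl (not_subsingleton_iff_nontrivial.1 hc)
    norm_cast at this
    omega
  · rintro h _ i rfl hi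
    by_contra hc
    have hc : i < n := by simpa using hc
    have := (ext_old_iff _ _ _ _).2 (h i hc)
    exact not_subsingleton _ this

lemma ext_shift (A : Type) [CommRing A] [IsLocalRing A]
    (N N' : Type) [AddCommGroup N] [Module A N] [AddCommGroup N'] [Module A N']
    (x : A) (hx : x ∈ IsLocalRing.maximalIdeal A) (hreg : IsSMulRegular N x)
    (g : N →ₗ[A] N') (hg : Function.Surjective g)
    (he : Function.Exact (LinearMap.lsmul A N x) g) (n : ℕ) :
    (n + 1 : ℕ) ≤ moduleDepth A N ↔ n ≤ moduleDepth A N' := by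
  let S : ShortComplex (ModuleCat A) :=
    ModuleCat.shortComplexOfCompEqZero (LinearMap.lsmul A N x) g he.linearMap_comp_eq_zero
  have hS : S.ShortExact :=
    { exact := ModuleCat.shortComplex_exact _ he
      mono_f := by simpa [S, ModuleCat.mono_iff_injective] using! hreg
      epi_g := by simpa [S, ModuleCat.epi_iff_surjective] using! hg }
  let k := ModuleCat.of A (IsLocalRing.ResidueField A)
  have hk : x ∈ Module.annihilator A k := by
    rw [Module.mem_annihilator]
    intro m
    change x • (m : IsLocalRing.ResidueField A) = 0
    have h0 : algebraMap A (IsLocalRing.ResidueField A) x = 0 :=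
      (IsLocalRing.residue_eq_zero_iff x).2 hx
    rw [Algebra.smul_def, h0, zero_mul]
  rw [le_moduleDepth, le_moduleDepth]
  have key : ∀ i, AddCommGrpCat.ofHom ((Abelian.Ext.mk₀ S.f).postcomp k (add_zero i)) = 0 := fun i ↦
    Abelian.Ext.postcomp_smul_id_eq_zero_of_mem_annihilator (M := ModuleCat.of A N) hk i
  constructor
  · intro h i hi
    have zero1 := AddCommGrpCat.isZero_of_iff_subsingleton.mpr (h i (by omega))
    have zero2 := AddCommGrpCat.isZero_of_iff_subsingleton.mpr (h (i + 1) (by omega))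
    exact AddCommGrpCat.subsingleton_of_isZero <| ShortComplex.Exact.isZero_of_both_zeros
        ((Abelian.Ext.covariant_sequence_exact₃' k hS) i (i + 1) rfl)
        (zero1.eq_zero_of_src _) (zero2.eq_zero_of_tgt _)
  · intro h i hi
    cases i with
    | zero =>
      have : Subsingleton (k →ₗ[A] N) :=
        IsSMulRegular.linearMap_subsingleton_of_mem_annihilator hreg hk
      exact (Abelian.Ext.addEquiv₀.trans ModuleCat.homAddEquiv).subsingleton
    | succ i =>
      have zero1 := AddCommGrpCat.isZero_of_iff_subsingleton.mpr (h i (by omega))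
      exact AddCommGrpCat.subsingleton_of_isZero <| ShortComplex.Exact.isZero_of_both_zeros
        ((Abelian.Ext.covariant_sequence_exact₁' k hS) i (i + 1) rfl)
        (zero1.eq_zero_of_src _) (key _)

lemma one_le_moduleDepth_iff (A : Type) [CommRing A] [IsLocalRing A] [IsNoetherianRing A]
    (N : Type) [AddCommGroup N] [Module A N] [Module.Finite A N] :
    (1 : ℕ) ≤ moduleDepth A N ↔ ∃ x ∈ IsLocalRing.maximalIdeal A, IsSMulRegular N x := by
  rw [le_moduleDepth]
  have : Module.annihilator A (IsLocalRing.ResidueField A) = IsLocalRing.maximalIdeal A :=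
    Ideal.annihilator_quotient
  rw [← this]
  rw [← IsSMulRegular.subsingleton_linearMap_iff]
  rw [(ModuleCat.homAddEquiv (M := ModuleCat.of A (IsLocalRing.ResidueField A))
    (N := ModuleCat.of A N)).symm.subsingleton_congr]
  rw [← (Abelian.Ext.addEquiv₀ (X := ModuleCat.of A (IsLocalRing.ResidueField A))
    (Y := ModuleCat.of A N)).subsingleton_congr]
  exact ⟨fun h ↦ h 0 (by simp), fun h i hi ↦ by obtain rfl : i = 0 := by omega
                                                exact h⟩

lemma not_one_le_moduleDepth_iff (A : Type) [CommRing A] [IsLocalRing A] [IsNoetherianRing A]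
    (N : Type) [AddCommGroup N] [Module A N] [Module.Finite A N] :
    ¬ (1 : ℕ) ≤ moduleDepth A N ↔ IsLocalRing.maximalIdeal A ∈ associatedPrimes A N := by
  constructor
  · intro h
    rw [one_le_moduleDepth_iff] at h
    have hann : Module.annihilator A (IsLocalRing.ResidueField A) = IsLocalRing.maximalIdeal A :=
      Ideal.annihilator_quotient
    rw [← hann, ← IsSMulRegular.subsingleton_linearMap_iff,
      not_subsingleton_iff_nontrivial] at h
    obtain ⟨f, hf⟩ := exists_ne (0 : IsLocalRing.ResidueField A →ₗ[A] N)
    rw [AssociatedPrimes.mem_iff, isAssociatedPrime_iff_exists_injective_linearMap]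
    have : IsSimpleModule A (IsLocalRing.ResidueField A) :=
      isSimpleModule_iff_quot_maximal.2
        ⟨IsLocalRing.maximalIdeal A, inferInstance, ⟨LinearEquiv.refl A _⟩⟩
    have hinj : Function.Injective f := LinearMap.injective_of_ne_zero hf
    exact ⟨inferInstance, f, hinj⟩
  · intro h h1
    obtain ⟨x, hx, hr⟩ := (one_le_moduleDepth_iff A N).1 h1
    obtain ⟨-, y, hy⟩ := isAssociatedPrime_iff.1 h
    have hxy : x • y = 0 := by
      rw [hy] at hx
      simpa [Submodule.mem_colon_singleton] using hx
    have hy0 : y = 0 := hr.right_eq_zero_of_smul hxy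
    have : (1 : A) ∈ IsLocalRing.maximalIdeal A := by
      rw [hy, Submodule.mem_colon_singleton]
      simp [hy0]
    exact (Ideal.ne_top_iff_one _).1 (IsLocalRing.maximalIdeal.isMaximal A).ne_top this

lemma not_one_le_moduleDepth_loc_iff (R : Type) [CommRing R] [IsNoetherianRing R]
    (M : Type) [AddCommGroup M] [Module R M] [Module.Finite R M] (p : Ideal R) [p.IsPrime] :
    ¬ (1 : ℕ) ≤ moduleDepth (Localization.AtPrime p) (LocalizedModule p.primeCompl M) ↔
      p ∈ associatedPrimes R M := by
  have : Module.Finite (Localization.AtPrime p) (LocalizedModule p.primeCompl M) :=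
    Module.Finite.of_isLocalizedModule p.primeCompl (LocalizedModule.mkLinearMap p.primeCompl M)
  have : IsNoetherianRing (Localization.AtPrime p) :=
    IsLocalization.isNoetherianRing p.primeCompl _ inferInstance
  rw [not_one_le_moduleDepth_iff]
  rw [← Module.associatedPrimes.preimage_comap_associatedPrimes_eq_associatedPrimes_of_isLocalizedModule
    p.primeCompl (Localization.AtPrime p) (LocalizedModule.mkLinearMap p.primeCompl M),
    Set.mem_preimage]
  have : Ideal.comap (algebraMap R (Localization.AtPrime p))
      (IsLocalRing.maximalIdeal (Localization.AtPrime p)) = p :=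
    Localization.AtPrime.under_maximalIdeal
  rw [this]

lemma loc_mk_eq_zero_iff {R : Type} [CommRing R] {T : Submonoid R} {M : Type} [AddCommGroup M]
    [Module R M] (m : M) (s : T) :
    LocalizedModule.mk m s = 0 ↔ ∃ u ∈ T, u • m = 0 := by
  rw [← LocalizedModule.zero_mk s, LocalizedModule.mk_eq]
  constructor
  · rintro ⟨u, hu⟩
    refine ⟨u * s, T.mul_mem u.2 s.2, ?_⟩
    rw [mul_smul]
    simpa [Submonoid.smul_def] using hu
  · rintro ⟨u, hu, h⟩
    refine ⟨⟨u, hu⟩, ?_⟩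
    rw [smul_comm]
    simp [Submonoid.smul_def, h]

lemma reg_loc_iff (R : Type) [CommRing R] (T : Submonoid R) (M : Type) [AddCommGroup M]
    [Module R M] (x : R) :
    IsSMulRegular (LocalizedModule T M) (algebraMap R (Localization T) x) ↔
      ∀ m : M, ∀ t ∈ T, t • x • m = 0 → ∃ u ∈ T, u • m = 0 := by
  rw [isSMulRegular_iff_right_eq_zero_of_smul]
  constructor
  · intro h m t ht htm
    have := h (LocalizedModule.mk m 1) (by
      rw [algebraMap_smul, LocalizedModule.smul'_mk, loc_mk_eq_zero_iff]
      exact ⟨t, ht, htm⟩)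
    rw [loc_mk_eq_zero_iff] at this
    exact this
  · intro h y hy
    induction y using LocalizedModule.induction_on with
    | h m s =>
      rw [algebraMap_smul, LocalizedModule.smul'_mk, loc_mk_eq_zero_iff] at hy
      obtain ⟨t, ht, htm⟩ := hy
      rw [loc_mk_eq_zero_iff]
      exact h m t ht htm

lemma one_le_loc (R : Type) [CommRing R] [IsNoetherianRing R]
    (M : Type) [AddCommGroup M] [Module R M] [Module.Finite R M] (p : Ideal R) [p.IsPrime]
    (h : (1 : ℕ) ≤ moduleDepth (Localization.AtPrime p) (LocalizedModule p.primeCompl M)) :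
    ∃ x ∈ p, IsSMulRegular (LocalizedModule p.primeCompl M)
      (algebraMap R (Localization.AtPrime p) x) := by
  have : Module.Finite (Localization.AtPrime p) (LocalizedModule p.primeCompl M) :=
    Module.Finite.of_isLocalizedModule p.primeCompl (LocalizedModule.mkLinearMap p.primeCompl M)
  have : IsNoetherianRing (Localization.AtPrime p) :=
    IsLocalization.isNoetherianRing p.primeCompl _ inferInstance
  obtain ⟨y, hy, hr⟩ := (one_le_moduleDepth_iff _ _).1 h
  obtain ⟨⟨x, s⟩, hx⟩ := IsLocalization.surj p.primeCompl y
  refine ⟨x, ?_, ?_⟩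
  · rw [← IsLocalization.AtPrime.to_map_mem_maximal_iff (Localization.AtPrime p) p, ← hx]
    exact Ideal.mul_mem_right _ _ hy
  · dsimp only at hx
    rw [← hx]
    exact hr.mul ((IsLocalization.map_units _ s).isSMulRegular _)

lemma shift_loc (R : Type) [CommRing R]
    (M M' : Type) [AddCommGroup M] [Module R M] [AddCommGroup M'] [Module R M']
    (p : Ideal R) [p.IsPrime] (x : R) (hx : x ∈ p)
    (hreg : IsSMulRegular (LocalizedModule p.primeCompl M)
      (algebraMap R (Localization.AtPrime p) x))
    (g : M →ₗ[R] M') (hg : Function.Surjective g)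
    (he : Function.Exact (LinearMap.lsmul R M x) g) (n : ℕ) :
    (n + 1 : ℕ) ≤ moduleDepth (Localization.AtPrime p) (LocalizedModule p.primeCompl M) ↔
    n ≤ moduleDepth (Localization.AtPrime p) (LocalizedModule p.primeCompl M') := by
  refine ext_shift _ _ _ (algebraMap R (Localization.AtPrime p) x)
    ((IsLocalization.AtPrime.to_map_mem_maximal_iff (Localization.AtPrime p) p x).2 hx) hreg
    (LocalizedModule.map p.primeCompl g) (LocalizedModule.map_surjective _ g hg) ?_ n
  have := LocalizedModule.map_exact p.primeCompl _ g he
  have e : ⇑(LinearMap.lsmul (Localization.AtPrime p) (LocalizedModule p.primeCompl M)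
      (algebraMap R (Localization.AtPrime p) x)) =
      LocalizedModule.map p.primeCompl (LinearMap.lsmul R M x) := by
    funext y
    induction y using LocalizedModule.induction_on with
    | h m s =>
      simp [LocalizedModule.map_mk, LocalizedModule.smul'_mk]
  rw [e]
  exact this

lemma exists_ass_over (R S : Type) [CommRing R] [IsNoetherianRing R] [CommRing S]
    [IsNoetherianRing S] [Algebra R S]
    (M : Type) [AddCommGroup M] [Module S M] [Module R M] [IsScalarTower R S M]
    (p : Ideal R) (hp : p ∈ associatedPrimes R M) :
    ∃ q ∈ associatedPrimes S M, q.comap (algebraMap R S) = p := by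
  obtain ⟨hpp, y, hy⟩ := isAssociatedPrime_iff.1 hp
  let J := Module.annihilator S (Submodule.span S {y})
  have hJ : J.comap (algebraMap R S) = p := by
    ext r
    rw [hy, Submodule.mem_colon_singleton, Ideal.mem_comap, Submodule.mem_annihilator_span_singleton,
      algebraMap_smul, Submodule.mem_bot]
  obtain ⟨q, hq, hqp⟩ := Ideal.exists_minimalPrimes_comap_eq (I := J) (algebraMap R S) p (by
    rw [hJ, Ideal.minimalPrimes_eq_subsingleton_self]; rfl)
  refine ⟨q, ?_, hqp⟩
  exact associatedPrimes.subset_of_injective (Submodule.injective_subtype (Submodule.span S {y}))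
    (Module.associatedPrimes.minimalPrimes_annihilator_subset_associatedPrimes S _ hq)

lemma main_iff (R S : Type) [CommRing R] [IsNoetherianRing R] [CommRing S] [IsNoetherianRing S]
    [Algebra R S] [Module.Finite R S] (p : Ideal R) [p.IsPrime] (n : ℕ) :
    ∀ (M : Type) [AddCommGroup M] [Module S M] [Module.Finite S M]
    [Module R M] [IsScalarTower R S M],
    n ≤ moduleDepth (Localization.AtPrime p) (LocalizedModule p.primeCompl M) ↔
      ∀ (q : Ideal S) (_ : q.IsPrime), q.comap (algebraMap R S) = p →
        n ≤ moduleDepth (Localization.AtPrime q) (LocalizedModule q.primeCompl M) := by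
  induction n with
  | zero => simp
  | succ n ih =>
    intro M _ _ _ _ _
    have : Module.Finite R M := Module.Finite.trans S M
    by_cases hex : (1 : ℕ) ≤ moduleDepth (Localization.AtPrime p) (LocalizedModule p.primeCompl M)
    · obtain ⟨x, hx, hr⟩ := one_le_loc R M p hex
      let g := (LinearMap.range (LinearMap.lsmul S M (algebraMap R S x))).mkQ
      have hg : Function.Surjective g := Submodule.mkQ_surjective _
      have he : Function.Exact (LinearMap.lsmul S M (algebraMap R S x)) g :=
        LinearMap.exact_map_mkQ_range _
      rw [shift_loc R M _ p x hx hr (g.restrictScalars R) hg (by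
        intro y
        rw [LinearMap.coe_restrictScalars, he y]
        simp [algebraMap_smul]), ih]
      refine forall_congr' fun q ↦ forall_congr' fun hq ↦ forall_congr' fun hqp ↦ ?_
      subst hqp
      refine (shift_loc S M _ q (algebraMap R S x) hx ?_ g hg he n).symm
      rw [reg_loc_iff] at hr ⊢
      intro m t ht htm
      obtain ⟨u, hu, hum⟩ := hr (t • m) 1 (one_mem _) (by
        rw [one_smul, ← algebraMap_smul S x (t • m), smul_comm, htm])
      refine ⟨algebraMap R S u * t, q.primeCompl.mul_mem hu ht, ?_⟩
      rw [mul_smul, algebraMap_smul, hum]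
    · have h1 : (1 : ℕ∞) ≤ ((n + 1 : ℕ) : ℕ∞) := by norm_cast; omega
      refine iff_of_false (fun h ↦ hex (le_trans (by exact_mod_cast h1) h)) fun h ↦ ?_
      obtain ⟨q, hq, hqp⟩ := exists_ass_over R S M p
        ((not_one_le_moduleDepth_loc_iff R M p).1 hex)
      have : q.IsPrime := hq.isPrime
      exact (not_one_le_moduleDepth_loc_iff S M q).2 hq
        (le_trans (by exact_mod_cast h1) (h q this hqp))

/-- Let `R → S` be a finite homomorphism of commutative noetherian rings and `M` a
finitely generated `S`-module.  Then for every prime `𝔭` of `R`,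
`depth_{R_𝔭} M_𝔭 = inf { depth_{S_𝔮} M_𝔮 : 𝔮 ∈ Spec S lying over 𝔭 }`. -/
theorem depth_localization_finite_algebra
    (R S : Type) [CommRing R] [IsNoetherianRing R] [CommRing S] [IsNoetherianRing S]
    [Algebra R S] [Module.Finite R S]
    (M : Type) [AddCommGroup M] [Module S M] [Module.Finite S M]
    [Module R M] [IsScalarTower R S M]
    (p : Ideal R) [p.IsPrime] :
    moduleDepth (Localization.AtPrime p) (LocalizedModule p.primeCompl M) =
      sInf {d : ℕ∞ | ∃ (q : Ideal S) (_ : q.IsPrime),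
        q.comap (algebraMap R S) = p ∧
        d = moduleDepth (Localization.AtPrime q) (LocalizedModule q.primeCompl M)} := by
  refine ENat.eq_of_forall_natCast_le_iff fun n ↦ ?_
  rw [main_iff R S p n M, le_sInf_iff]
  constructor
  · rintro h _ ⟨q, hq, hqp, rfl⟩
    exact h q hq hqp
  · intro h q hq hqp
    exact h _ ⟨q, hq, hqp, rfl⟩
end
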